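/- Fix n ≥ 1 and 1 ≤ k ≤ 1+n. For every k-form ω on V = ℝ^{1+n} and every observer U: ⟨ω, ω⟩ = (−1)^{k−1} ( |E_U|² − |B_U|² ), where |E_U|² := (−1)^{k−1}⟨i_U ω, i_U ω⟩ and |B_U|² := (−1)^{k}⟨U* ∧ ω, U* ∧ ω⟩. -/

import Mathlib

namespace Paper

noncomputable section

/-- The vector space `V = ℝ^{1+n}`. -/
abbrev V (n : ℕ) := Fin (n + 1) → ℝ

/-- The standard basis vectors `e₀, …, e_n`. -/
def eb (n : ℕ) (i : Fin (n + 1)) : V n := Pi.single i 1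

/-- The signs `ε₀ = 1`, `ε_i = -1` for `i ≠ 0`. -/
def eps (n : ℕ) (i : Fin (n + 1)) : ℝ := if i = 0 then 1 else -1

/-- The Minkowski bilinear form `η(x,y) = x₀y₀ − Σᵢ xᵢyᵢ`. -/
def mink (n : ℕ) (x y : V n) : ℝ := ∑ i, eps n i * x i * y i

/-- An observer: a unitary timelike vector oriented to the future. -/
def IsObserver (n : ℕ) (U : V n) : Prop := mink n U U = 1 ∧ 0 < mink n U (eb n 0)

open Classical in
/-- The induced scalar product of two (raw) `k`-forms:
`⟨ω, ω̄⟩ = Σ_{i₁ < ⋯ < i_k} ε_{i₁}⋯ε_{i_k} ω(e_{i₁},…,e_{i_k}) ω̄(e_{i₁},…,e_{i_k})`. -/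
def finner (n k : ℕ) (ω ω' : (Fin k → V n) → ℝ) : ℝ :=
  ∑ v ∈ Finset.univ.filter (fun v : Fin k → Fin (n + 1) => StrictMono v),
    (∏ j, eps n (v j)) * ω (fun j => eb n (v j)) * ω' (fun j => eb n (v j))

/-- Interior product `i_D ω = ω(D, −, …, −)` of a vector with a (raw) `k`-form. -/
def inter (n k : ℕ) (D : V n) (ω : (Fin k → V n) → ℝ) : (Fin (k - 1) → V n) → ℝ :=
  fun v => ω (fun j => if h : (j : ℕ) = 0 then D
    else v ⟨(j : ℕ) - 1, by have := j.isLt; omega⟩)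

/-- The metrically equivalent `1`-form `U* = η(U, −)`. -/
def ustar (n : ℕ) (U : V n) : V n → ℝ := fun w => mink n U w

/-- Wedge product of a `1`-form with a (raw) `k`-form:
`(α ∧ ω)(v₀,…,v_k) = Σ_j (−1)^j α(v_j) ω(v₀,…,v̂_j,…,v_k)`. -/
def wedge1 (n k : ℕ) (α : V n → ℝ) (ω : (Fin k → V n) → ℝ) : (Fin (k + 1) → V n) → ℝ :=
  fun v => ∑ j : Fin (k + 1), (-1 : ℝ) ^ (j : ℕ) * α (v j) * ω (v ∘ j.succAbove)

/-- The electric part `E_U = U* ∧ i_U ω` of a `k`-form with respect to an observer `U`. -/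
def EU (n k : ℕ) (U : V n) (ω : (Fin k → V n) → ℝ) : (Fin (k - 1 + 1) → V n) → ℝ :=
  wedge1 n (k - 1) (ustar n U) (inter n k U ω)

/-- The magnetic part `B_U = i_U (U* ∧ ω)` of a `k`-form with respect to an observer `U`. -/
def BU (n k : ℕ) (U : V n) (ω : (Fin k → V n) → ℝ) : (Fin k → V n) → ℝ :=
  inter n (k + 1) U (wedge1 n k (ustar n U) ω)

/-- Reindexing a raw form along an equality of degrees. -/
def reind (n : ℕ) {m m' : ℕ} (h : m = m') (ω : (Fin m → V n) → ℝ) : (Fin m' → V n) → ℝ :=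
  fun v => ω (fun j => v (Fin.cast h j))

/-- The energy tensor of a `k`-form:
`(−1)^{k−1} T(D₁,D₂) = ⟨i_{D₁}ω, i_{D₂}ω⟩ − (1/2)⟨ω,ω⟩ η(D₁,D₂)`. -/
def energyT (n k : ℕ) (ω : (Fin k → V n) → ℝ) (D₁ D₂ : V n) : ℝ :=
  (-1 : ℝ) ^ (k - 1) * (finner n (k - 1) (inter n k D₁ ω) (inter n k D₂ ω)
    - (1 / 2) * finner n k ω ω * mink n D₁ D₂)

/-- The volume form `dX`, with `dX(e₀,…,e_n) = 1`. -/
def dX (n : ℕ) (u : Fin (n + 1) → V n) : ℝ := Matrix.det (Matrix.of fun i j => u i j)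

/-- The Hodge star of a (raw) `k`-form:
`(*ω)(v₁,…,v_{1+n−k}) = (1/k!) Σ_{i₁,…,i_k} ε_{i₁}⋯ε_{i_k} ω(e_{i₁},…,e_{i_k})
  dX(e_{i₁},…,e_{i_k},v₁,…,v_{1+n−k})`. -/
def hodge (n k : ℕ) (ω : (Fin k → V n) → ℝ) : (Fin (n + 1 - k) → V n) → ℝ :=
  fun v => (1 / (k.factorial : ℝ)) * ∑ i : Fin k → Fin (n + 1),
    (∏ j, eps n (i j)) * ω (fun j => eb n (i j)) *
      dX n (fun l => if h : (l : ℕ) < k then eb n (i ⟨(l : ℕ), h⟩)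
        else v ⟨(l : ℕ) - k, by have := l.isLt; omega⟩)

/-- The bilinear form associated to a matrix `g`. -/
def gbil (n : ℕ) (g : Matrix (Fin (n + 1)) (Fin (n + 1)) ℝ) (x y : V n) : ℝ :=
  ∑ a, ∑ b, g a b * x a * y b

/-- The scalar product of two (raw) `k`-forms with respect to a metric `g` (indices raised
with the inverse matrix `g⁻¹`):
`⟨ω,ω̄⟩_g = (1/k!) Σ g^{i₁j₁}⋯g^{i_kj_k} ω_{i₁…i_k} ω̄_{j₁…j_k}`. -/
def ginner (n : ℕ) (g : Matrix (Fin (n + 1)) (Fin (n + 1)) ℝ) (k : ℕ)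
    (ω ω' : (Fin k → V n) → ℝ) : ℝ :=
  (1 / (k.factorial : ℝ)) * ∑ v : Fin k → Fin (n + 1), ∑ w : Fin k → Fin (n + 1),
    (∏ j, g⁻¹ (v j) (w j)) * ω (fun j => eb n (v j)) * ω' (fun j => eb n (w j))

/-- The energy tensor of a `k`-form with respect to a metric `g`:
`T(g,ω)(D₁,D₂) = (−1)^{k−1}( ⟨i_{D₁}ω, i_{D₂}ω⟩_g − (1/2)⟨ω,ω⟩_g g(D₁,D₂) )`. -/
def energyTg (n : ℕ) (g : Matrix (Fin (n + 1)) (Fin (n + 1)) ℝ) (k : ℕ)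
    (ω : (Fin k → V n) → ℝ) (D₁ D₂ : V n) : ℝ :=
  (-1 : ℝ) ^ (k - 1) * (ginner n g (k - 1) (inter n k D₁ ω) (inter n k D₂ ω)
    - (1 / 2) * ginner n g k ω ω * gbil n g D₁ D₂)

end

end Paper

namespace Paper

/-- A sum over all index tuples of a permutation-invariant function that vanishes off the injective
tuples is `k!` times the sum over strictly increasing tuples. -/
theorem sum_eq_factorial_mul_sum_strictMono {ι : Type*} [Fintype ι] [LinearOrder ι] {k : ℕ}
    [DecidablePred fun v : Fin k → ι => StrictMono v] (F : (Fin k → ι) → ℝ)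
    (hperm : ∀ v (σ : Equiv.Perm (Fin k)), F (v ∘ σ) = F v)
    (hinj : ∀ v, ¬ Function.Injective v → F v = 0) :
    ∑ v, F v = k.factorial * ∑ v ∈ Finset.univ.filter (fun v : Fin k → ι => StrictMono v), F v := by
  classical
  have hsum : ∑ p ∈ (Finset.univ.filter fun v : Fin k → ι => StrictMono v) ×ˢ
        (Finset.univ : Finset (Equiv.Perm (Fin k))), F p.1 =
      ∑ v ∈ Finset.univ.filter (fun v : Fin k → ι => Function.Injective v), F v := by
    refine Finset.sum_bij (fun p _ => p.1 ∘ p.2) ?_ ?_ ?_ ?_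
    · rintro ⟨v, σ⟩ hp
      have hv : StrictMono v := by simpa using hp
      simpa using hv.injective
    · rintro ⟨v, σ⟩ hp ⟨w, τ⟩ hq heq
      have hv : StrictMono v := by simpa using hp
      have hw : StrictMono w := by simpa using hq
      simp only at heq
      have hrange : Set.range v = Set.range w := by
        rw [← σ.surjective.range_comp v, heq, τ.surjective.range_comp]
      obtain rfl := (hv.range_inj hw).1 hrange
      congr 1
      ext1 i
      exact hv.injective (congrFun heq i)
    · intro w hw
      have hw : Function.Injective w := by simpa using hw
      refine ⟨(w ∘ Tuple.sort w, (Tuple.sort w)⁻¹), ?_, ?_⟩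
      · simpa using (Tuple.monotone_sort w).strictMono_of_injective
          (hw.comp (Tuple.sort w).injective)
      · ext i
        simp
    · rintro ⟨v, σ⟩ -
      exact (hperm v σ).symm
  rw [← Finset.sum_filter_of_ne (p := fun v => Function.Injective v)
    (fun v _ hv => by_contra fun h => hv (hinj v h)), ← hsum, Finset.sum_product]
  simp [Fintype.card_perm, Finset.mul_sum]

/-- The scalar product of `k`-forms as a sum over all index tuples. -/
theorem factorial_mul_finner (n k : ℕ) (ω θ : AlternatingMap ℝ (V n) ℝ (Fin k)) :
    k.factorial * finner n k ω θ = ∑ v : Fin k → Fin (n + 1),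
      (∏ j, eps n (v j)) * ω (fun j => eb n (v j)) * θ (fun j => eb n (v j)) := by
  classical
  rw [finner, sum_eq_factorial_mul_sum_strictMono fun v : Fin k → Fin (n + 1) =>
    (∏ j, eps n (v j)) * ω (fun j => eb n (v j)) * θ (fun j => eb n (v j))]
  · intro v σ
    have hω := ω.map_perm (fun j => eb n (v j)) σ
    have hθ := θ.map_perm (fun j => eb n (v j)) σ
    simp only [Function.comp_def] at hω hθ ⊢
    rw [hω, hθ, Equiv.prod_comp σ fun j => eps n (v j)]
    rcases Int.units_eq_one_or (Equiv.Perm.sign σ) with h | h <;> simp [h]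
  · intro v hv
    rw [ω.map_eq_zero_of_not_injective _ fun h => hv fun i j hij => h (by simp [hij])]
    simp

theorem eps_mul_self (n : ℕ) (i : Fin (n + 1)) : eps n i * eps n i = 1 := by
  unfold eps
  split_ifs <;> norm_num

theorem ustar_eb (n : ℕ) (U : V n) (i : Fin (n + 1)) : ustar n U (eb n i) = eps n i * U i := by
  simp [ustar, mink, eb, Pi.single_apply]

/-- `U* = η(U, −)` as a linear map. -/
def ustarLinear (n : ℕ) (U : V n) : V n →ₗ[ℝ] ℝ where
  toFun := ustar n U
  map_add' x y := by simp [ustar, mink, mul_add, Finset.sum_add_distrib]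
  map_smul' c x := by
    simp only [ustar, mink, Finset.mul_sum, Pi.smul_apply, smul_eq_mul, RingHom.id_apply]
    exact Finset.sum_congr rfl fun i _ => by ring

/-- `U* ∧ ω` as an alternating map. -/
def wedgeUstar (n k : ℕ) (U : V n) (ω : AlternatingMap ℝ (V n) ℝ (Fin k)) :
    AlternatingMap ℝ (V n) ℝ (Fin (k + 1)) :=
  AlternatingMap.alternatizeUncurryFin ((ustarLinear n U).smulRight ω)

theorem coe_wedgeUstar (n k : ℕ) (U : V n) (ω : AlternatingMap ℝ (V n) ℝ (Fin k)) :
    ⇑(wedgeUstar n k U ω) = wedge1 n k (ustar n U) ω := by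
  ext v
  simp only [wedgeUstar, wedge1, AlternatingMap.alternatizeUncurryFin_apply, mul_assoc,
    LinearMap.smulRight_apply, AlternatingMap.smul_apply, zsmul_eq_mul, smul_eq_mul]
  push_cast
  rfl

theorem inter_succ (n k : ℕ) (U : V n) (ω : (Fin (k + 1) → V n) → ℝ) (v : Fin k → V n) :
    inter n (k + 1) U ω v = ω (Fin.cons U v) := by
  unfold inter
  congr 1
  ext1 j
  cases j using Fin.cases <;> simp

theorem coe_curryLeft (n k : ℕ) (U : V n) (ω : AlternatingMap ℝ (V n) ℝ (Fin (k + 1))) :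
    ⇑(ω.curryLeft U) = inter n (k + 1) U ω := by
  ext v
  exact (inter_succ n k U ω v).symm

theorem sum_smul_eb (n : ℕ) (U : V n) : ∑ i, U i • eb n i = U := by
  ext j
  simp [eb, Pi.single_apply]

theorem curryLeft_eq_sum (n k : ℕ) (U : V n) (θ : AlternatingMap ℝ (V n) ℝ (Fin (k + 1)))
    (v : Fin k → V n) : θ.curryLeft U v = ∑ i, U i * θ.curryLeft (eb n i) v := by
  have h := congrArg (fun f => AlternatingMap.toMultilinearMapLM (S := ℝ) f v)
    (congrArg θ.curryLeft (sum_smul_eb n U))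
  simp only [map_sum, map_smul, sum_apply] at h
  exact h.symm

/-- The wedge product with `U*` is adjoint to the interior product with `U`. -/
theorem finner_wedge1_ustar (n k : ℕ) (U : V n) (ω : AlternatingMap ℝ (V n) ℝ (Fin k))
    (θ : AlternatingMap ℝ (V n) ℝ (Fin (k + 1))) :
    finner n (k + 1) (wedge1 n k (ustar n U) ω) θ = finner n k ω (inter n (k + 1) U θ) := by
  have hfac : ((k + 1).factorial : ℝ) ≠ 0 := by positivity
  refine mul_left_cancel₀ hfac ?_
  rw [← coe_wedgeUstar, factorial_mul_finner, Nat.factorial_succ, Nat.cast_mul, mul_assoc,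
    ← coe_curryLeft, factorial_mul_finner, coe_wedgeUstar]
  simp only [wedge1, Finset.mul_sum, Finset.sum_mul]
  rw [Finset.sum_comm]
  have hterm (i : Fin (k + 1)) : ∑ v : Fin (k + 1) → Fin (n + 1),
      (∏ j, eps n (v j)) * ((-1) ^ (i : ℕ) * ustar n U (eb n (v i)) *
        ω ((fun j => eb n (v j)) ∘ i.succAbove)) * θ (fun j => eb n (v j)) =
      ∑ w : Fin k → Fin (n + 1), (∏ j, eps n (w j)) * ω (fun j => eb n (w j)) *
        θ.curryLeft U (fun j => eb n (w j)) := by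
    rw [← (Fin.insertNthEquiv (fun _ => Fin (n + 1)) i).sum_comp, Fintype.sum_prod_type_right]
    refine Finset.sum_congr rfl fun w _ => ?_
    rw [curryLeft_eq_sum, Finset.mul_sum]
    refine Finset.sum_congr rfl fun a _ => ?_
    have hins : (fun j => eb n ((i.insertNth a w : Fin (k + 1) → Fin (n + 1)) j)) =
        i.insertNth (eb n a) fun j => eb n (w j) := by
      ext1 j
      cases j using Fin.succAboveCases i <;> simp
    have hθ := θ.neg_one_pow_smul_map_insertNth i (eb n a) fun j => eb n (w j)
    simp only [Fin.insertNthEquiv_apply, hins, Fin.prod_univ_succAbove _ i, Fin.insertNth_apply_same,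
      Fin.insertNth_apply_succAbove, Function.comp_def, ustar_eb, AlternatingMap.curryLeft_apply_apply]
      at hθ ⊢
    rw [← hθ]
    linear_combination (∏ j, eps n (w j)) * (-1) ^ (i : ℕ) * U a * ω (fun j => eb n (w j)) *
      θ (i.insertNth (eb n a) fun j => eb n (w j)) * eps_mul_self n a
  simp only [hterm, Finset.sum_const, Finset.card_univ, Fintype.card_fin, nsmul_eq_mul]
  simp [Finset.mul_sum]

/-- The interior product with `U` is an antiderivation: `i_U (U* ∧ ω) = η(U,U) ω − U* ∧ i_U ω`. -/
theorem inter_wedge1_ustar (n k : ℕ) (U : V n) (ω : AlternatingMap ℝ (V n) ℝ (Fin (k + 1)))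
    (v : Fin (k + 1) → V n) :
    inter n (k + 1 + 1) U (wedge1 n (k + 1) (ustar n U) ω) v =
      mink n U U * ω v - wedge1 n k (ustar n U) (inter n (k + 1) U ω) v := by
  have hcons (i : Fin (k + 1)) : (Fin.cons U v : Fin (k + 2) → V n) ∘ i.succ.succAbove =
      Fin.cons U (v ∘ i.succAbove) := by
    ext1 j
    cases j using Fin.cases <;> simp
  have hzero : (Fin.cons U v : Fin (k + 2) → V n) ∘ Fin.succAbove 0 = v := by
    ext1 j
    simp
  rw [inter_succ, wedge1, Fin.sum_univ_succ, hzero, wedge1, sub_eq_add_neg, ← Finset.sum_neg_distrib]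
  congr 1
  · simp [ustar]
  · refine Finset.sum_congr rfl fun i _ => ?_
    rw [hcons, inter_succ]
    simp [pow_succ]

theorem finner_comm (n k : ℕ) (ω θ : (Fin k → V n) → ℝ) : finner n k ω θ = finner n k θ ω :=
  Finset.sum_congr rfl fun _ _ => by ring

theorem finner_sub_right (n k : ℕ) (ω θ θ' : (Fin k → V n) → ℝ) :
    finner n k ω (θ - θ') = finner n k ω θ - finner n k ω θ' := by
  simp [finner, mul_sub]

/-- `⟨ω,ω⟩ = (−1)^{k−1}(|E_U|² − |B_U|²)`. -/
theorem statement9 (n k : ℕ) (hn : 1 ≤ n) (hk1 : 1 ≤ k) (hk2 : k ≤ n + 1)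
    (ω : AlternatingMap ℝ (V n) ℝ (Fin k)) (U : V n) (hU : IsObserver n U) :
    finner n k ⇑ω ⇑ω = (-1 : ℝ) ^ (k - 1) *
      (((-1 : ℝ) ^ (k - 1) * finner n (k - 1) (inter n k U ⇑ω) (inter n k U ⇑ω))
        - ((-1 : ℝ) ^ k *
            finner n (k + 1) (wedge1 n k (ustar n U) ⇑ω) (wedge1 n k (ustar n U) ⇑ω))) := by
  obtain ⟨m, rfl⟩ : ∃ m, k = m + 1 := ⟨k - 1, by omega⟩
  have hwedge : inter n (m + 1 + 1) U (wedge1 n (m + 1) (ustar n U) ω) =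
      ⇑ω - wedge1 n m (ustar n U) (inter n (m + 1) U ω) := by
    ext v
    simpa [hU.1] using inter_wedge1_ustar n m U ω v
  have hB : finner n (m + 1 + 1) (wedge1 n (m + 1) (ustar n U) ω)
      (wedge1 n (m + 1) (ustar n U) ω) =
      finner n (m + 1) ω ω - finner n m (inter n (m + 1) U ω) (inter n (m + 1) U ω) := by
    have hadj := finner_wedge1_ustar n (m + 1) U ω (wedgeUstar n (m + 1) U ω)
    have hE := finner_wedge1_ustar n m U (ω.curryLeft U) ω
    rw [coe_wedgeUstar, hwedge] at hadj
    rw [coe_curryLeft] at hE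
    exact hadj.trans <| (finner_sub_right ..).trans <|
      congrArg (finner n (m + 1) ω ω - ·) ((finner_comm ..).trans hE)
  have hsq : (-1 : ℝ) ^ m * (-1) ^ m = 1 := by rw [← mul_pow]; simp
  rw [hB]
  change finner n (m + 1) ω ω = (-1 : ℝ) ^ m *
    ((-1 : ℝ) ^ m * finner n m (inter n (m + 1) U ω) (inter n (m + 1) U ω) - (-1 : ℝ) ^ (m + 1) *
      (finner n (m + 1) ω ω - finner n m (inter n (m + 1) U ω) (inter n (m + 1) U ω)))
  linear_combination (-finner n (m + 1) ω ω) * hsq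

end Paper
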